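/- (λvsub Typed Genericity) Let t be a meaningless term of the λvsub-calculus. If there is a derivation in type system V of the judgment Γ ⊢ C⟨t⟩ : σ for some full context C, typing context Γ and type σ, then for every term u there is a derivation in system V of Γ ⊢ C⟨u⟩ : σ. -/

import Mathlib

/-- `i`-fold composition of a relation: `nSteps R i a b` holds iff `a` goes to
`b` in exactly `i` `R`-steps. -/
def nSteps {α : Type} (R : α → α → Prop) : ℕ → α → α → Prop
  | 0, a, b => a = b
  | n + 1, a, b => ∃ c, R a c ∧ nSteps R n c b

/-- Terms of the λvsub-calculus (value substitution calculus):
`sub t x u` is the explicit substitution `t[x←u]`, binding `x` in `t`. -/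
inductive VTerm : Type
  | var : ℕ → VTerm
  | lam : ℕ → VTerm → VTerm
  | app : VTerm → VTerm → VTerm
  | sub : VTerm → ℕ → VTerm → VTerm

/-- Values `v ::= x | λx.t`. -/
def VTerm.isValue : VTerm → Prop
  | .var _ => True
  | .lam _ _ => True
  | .app _ _ => False
  | .sub _ _ _ => False

/-- Free variables. -/
def VTerm.fv : VTerm → Finset ℕ
  | .var x => {x}
  | .lam x t => VTerm.fv t \ {x}
  | .app t u => VTerm.fv t ∪ VTerm.fv u
  | .sub t x u => (VTerm.fv t \ {x}) ∪ VTerm.fv u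

/-- Meta-level substitution `t{x:=v}`. -/
def VTerm.subst : VTerm → ℕ → VTerm → VTerm
  | .var y, x, v => if y = x then v else .var y
  | .lam y t, x, v => if y = x then .lam y t else .lam y (VTerm.subst t x v)
  | .app t u, x, v => .app (VTerm.subst t x v) (VTerm.subst u x v)
  | .sub t y u, x, v =>
      if y = x then .sub t y (VTerm.subst u x v)
      else .sub (VTerm.subst t x v) y (VTerm.subst u x v)

/-- List contexts `L ::= ⟨⟩ | L[x←t]`. -/
inductive VLCtx : Type
  | hole : VLCtx
  | sub : VLCtx → ℕ → VTerm → VLCtx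

def VLCtx.plug : VLCtx → VTerm → VTerm
  | .hole, t => t
  | .sub L x u, t => VTerm.sub (VLCtx.plug L t) x u

def VLCtx.binders : VLCtx → Finset ℕ
  | .hole => ∅
  | .sub L x _ => insert x (VLCtx.binders L)

/-- Root rewrite rules (βv) and (sv); the side conditions say that no free
variable is captured by the list context `L`. -/
inductive VRoot : VTerm → VTerm → Prop
  | beta (L : VLCtx) (x : ℕ) (s t : VTerm)
      (hcap : ∀ y ∈ VLCtx.binders L, y ∉ VTerm.fv t) :
      VRoot (.app (VLCtx.plug L (.lam x s)) t) (VLCtx.plug L (.sub s x t))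
  | subv (L : VLCtx) (t : VTerm) (x : ℕ) (v : VTerm)
      (hv : VTerm.isValue v)
      (hcap : ∀ y ∈ VLCtx.binders L, y ∉ VTerm.fv t \ {x}) :
      VRoot (.sub t x (VLCtx.plug L v)) (VLCtx.plug L (VTerm.subst t x v))

/-- Stratified reduction `→_{v_k}` for `k ∈ ℕ∪{ω}`, where `ω` is `⊤ : ℕ∞`:
the closure of the root rules under stratified contexts `S_k`.  The `lam`
rule raises the level by one; since `⊤ + 1 = ⊤`, level `⊤` (i.e. `ω`, full
reduction) allows reduction anywhere, while level `0` (surface reduction)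
forbids reduction under abstractions. -/
inductive VStep : ℕ∞ → VTerm → VTerm → Prop
  | root (k : ℕ∞) {t u : VTerm} : VRoot t u → VStep k t u
  | appL {k : ℕ∞} {t t' : VTerm} (u : VTerm) :
      VStep k t t' → VStep k (.app t u) (.app t' u)
  | appR {k : ℕ∞} (t : VTerm) {u u' : VTerm} :
      VStep k u u' → VStep k (.app t u) (.app t u')
  | subL {k : ℕ∞} {t t' : VTerm} (x : ℕ) (u : VTerm) :
      VStep k t t' → VStep k (.sub t x u) (.sub t' x u)
  | subR {k : ℕ∞} (t : VTerm) (x : ℕ) {u u' : VTerm} :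
      VStep k u u' → VStep k (.sub t x u) (.sub t x u')
  | lam {k : ℕ∞} (x : ℕ) {t t' : VTerm} :
      VStep k t t' → VStep (k + 1) (.lam x t) (.lam x t')

/-- `S_k`-normal terms: no `→_{v_k}` step applies. -/
def VNormal (k : ℕ∞) (t : VTerm) : Prop := ∀ u, ¬ VStep k t u

/-- Testing contexts `T ::= ⟨⟩ | T u | (λx.T) u`. -/
inductive VTCtx : Type
  | hole : VTCtx
  | app : VTCtx → VTerm → VTCtx
  | lamApp : ℕ → VTCtx → VTerm → VTCtx

def VTCtx.plug : VTCtx → VTerm → VTerm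
  | .hole, t => t
  | .app T u, t => .app (VTCtx.plug T t) u
  | .lamApp x T u, t => .app (.lam x (VTCtx.plug T t)) u

/-- A term is meaningful if some testing context sends it to a value by
surface reduction; otherwise it is meaningless. -/
def VMeaningful (t : VTerm) : Prop :=
  ∃ (T : VTCtx) (v : VTerm), VTerm.isValue v ∧
    Relation.ReflTransGen (VStep 0) (VTCtx.plug T t) v

/-- Full (one-hole) contexts `C ::= ⟨⟩ | λx.C | C t | t C | C[x←t] | t[x←C]`. -/
inductive VFCtx : Type
  | hole : VFCtx
  | lam : ℕ → VFCtx → VFCtx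
  | appL : VFCtx → VTerm → VFCtx
  | appR : VTerm → VFCtx → VFCtx
  | subL : VFCtx → ℕ → VTerm → VFCtx
  | subR : VTerm → ℕ → VFCtx → VFCtx

def VFCtx.plug : VFCtx → VTerm → VTerm
  | .hole, t => t
  | .lam x C, t => .lam x (VFCtx.plug C t)
  | .appL C u, t => .app (VFCtx.plug C t) u
  | .appR u C, t => .app u (VFCtx.plug C t)
  | .subL C x u, t => .sub (VFCtx.plug C t) x u
  | .subR u x C, t => .sub u x (VFCtx.plug C t)

/-- Types of system 𝒱: type variables, multiset types and arrows; multiset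
(intersection) types `M` are represented as lists of types. -/
inductive VTy : Type
  | tvar : ℕ → VTy
  | mult : List VTy → VTy
  | arr : List VTy → VTy → VTy

/-- The empty typing context. -/
def VCtxEmpty : ℕ → List VTy := fun _ => []

/-- The typing context `x : M`. -/
def VCtxSing (x : ℕ) (M : List VTy) : ℕ → List VTy :=
  fun y => if y = x then M else []

/-- Pointwise (multiset) sum of two typing contexts. -/
def VCtxAdd (Γ Δ : ℕ → List VTy) : ℕ → List VTy := fun y => Γ y ++ Δ y

/-- The typing context `Γ; x : M`. -/
def VCtxUpd (Γ : ℕ → List VTy) (x : ℕ) (M : List VTy) : ℕ → List VTy :=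
  fun y => if y = x then M else Γ y

/-- Sum of a finite family of typing contexts. -/
def VCtxSum : List (ℕ → List VTy) → (ℕ → List VTy)
  | [] => VCtxEmpty
  | Γ :: Γs => VCtxAdd Γ (VCtxSum Γs)

/-- Typing derivations of system 𝒱; finite families of premises are
represented as lists. -/
inductive VDer : (ℕ → List VTy) → VTerm → VTy → Prop
  | var (x : ℕ) (M : List VTy) : VDer (VCtxSing x M) (.var x) (.mult M)
  | lam (x : ℕ) (t : VTerm) (fam : List ((ℕ → List VTy) × List VTy × VTy)) :
      (∀ p ∈ fam, VDer (VCtxUpd p.1 x p.2.1) t p.2.2) →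
      VDer (VCtxSum (fam.map Prod.fst)) (.lam x t)
        (.mult (fam.map fun p => VTy.arr p.2.1 p.2.2))
  | app {Γ₁ Γ₂ : ℕ → List VTy} {t u : VTerm} (M : List VTy) (σ : VTy) :
      VDer Γ₁ t (.mult [VTy.arr M σ]) → VDer Γ₂ u (.mult M) →
      VDer (VCtxAdd Γ₁ Γ₂) (.app t u) σ
  | es {Γ₁ Γ₂ : ℕ → List VTy} {t u : VTerm} (x : ℕ) (M : List VTy) (σ : VTy) :
      VDer (VCtxUpd Γ₁ x M) t σ → VDer Γ₂ u (.mult M) →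
      VDer (VCtxAdd Γ₁ Γ₂) (.sub t x u) σ

open Relation

/-- Parallel (partial) substitution; `none` leaves a variable untouched. -/
def VTerm.msub : (ℕ → Option VTerm) → VTerm → VTerm
  | ρ, .var x => (ρ x).getD (.var x)
  | ρ, .lam x t => .lam x (VTerm.msub (Function.update ρ x none) t)
  | ρ, .app t u => .app (VTerm.msub ρ t) (VTerm.msub ρ u)
  | ρ, .sub t x u => .sub (VTerm.msub (Function.update ρ x none) t) x (VTerm.msub ρ u)

/-- Closed values. -/
def VTerm.ClosedValue (v : VTerm) : Prop := v.isValue ∧ v.fv = ∅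

/-- All terms in the range of a partial substitution are closed. -/
def ClosedRange (ρ : ℕ → Option VTerm) : Prop := ∀ x v, ρ x = some v → v.fv = ∅

theorem ClosedRange.update_none {ρ : ℕ → Option VTerm} (h : ClosedRange ρ) (x : ℕ) :
    ClosedRange (Function.update ρ x none) := by
  intro y v hy
  by_cases hxy : y = x
  · subst hxy; simp at hy
  · rw [Function.update_of_ne hxy] at hy
    exact h y v hy

theorem ClosedRange.update_some {ρ : ℕ → Option VTerm} (h : ClosedRange ρ) (x : ℕ)
    {w : VTerm} (hw : w.fv = ∅) : ClosedRange (Function.update ρ x (some w)) := by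
  intro y v hy
  by_cases hxy : y = x
  · subst hxy
    simp only [Function.update_self, Option.some.injEq] at hy
    rw [← hy, hw]
  · rw [Function.update_of_ne hxy] at hy
    exact h y v hy

theorem VTerm.msub_eq_self (t : VTerm) :
    ∀ ρ : ℕ → Option VTerm, (∀ x ∈ t.fv, ρ x = none) → t.msub ρ = t := by
  induction t with
  | var x => intro ρ h; simp [VTerm.msub, h x (by simp [VTerm.fv])]
  | lam x t ih =>
    intro ρ h
    rw [VTerm.msub, ih]
    intro y hy
    by_cases hxy : y = x
    · subst hxy; simp
    · rw [Function.update_of_ne hxy]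
      exact h y (by simp [VTerm.fv, hy, hxy])
  | app t u iht ihu =>
    intro ρ h
    rw [VTerm.msub, iht ρ fun y hy => h y (by simp [VTerm.fv, hy]),
      ihu ρ fun y hy => h y (by simp [VTerm.fv, hy])]
  | sub t x u iht ihu =>
    intro ρ h
    rw [VTerm.msub, ihu ρ fun y hy => h y (by simp [VTerm.fv, hy]), iht]
    intro y hy
    by_cases hxy : y = x
    · subst hxy; simp
    · rw [Function.update_of_ne hxy]
      exact h y (by simp [VTerm.fv, hy, hxy])

theorem VTerm.subst_eq_self (t : VTerm) (x : ℕ) (v : VTerm) (h : x ∉ t.fv) :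
    t.subst x v = t := by
  induction t with
  | var y =>
    have : y ≠ x := by rintro rfl; simp [VTerm.fv] at h
    simp [VTerm.subst, this]
  | lam y t ih =>
    by_cases hyx : y = x
    · simp [VTerm.subst, hyx]
    · simp only [VTerm.subst, hyx, if_false]
      rw [ih]
      intro hx
      exact h (by simp [VTerm.fv, hx, Ne.symm hyx])
  | app t u iht ihu =>
    simp only [VTerm.fv, Finset.mem_union, not_or] at h
    rw [VTerm.subst, iht h.1, ihu h.2]
  | sub t y u iht ihu =>
    simp only [VTerm.fv, Finset.mem_union, not_or] at h
    by_cases hyx : y = x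
    · simp [VTerm.subst, hyx, ihu h.2]
    · simp only [VTerm.subst, hyx, if_false]
      rw [ihu h.2, iht]
      intro hx
      exact h.1 (by simp [hx, Ne.symm hyx])

theorem VTerm.fv_msub (t : VTerm) :
    ∀ ρ : ℕ → Option VTerm, ClosedRange ρ → ∀ y ∈ (t.msub ρ).fv, y ∈ t.fv ∧ ρ y = none := by
  induction t with
  | var x =>
    intro ρ hρ y hy
    cases hx : ρ x with
    | none => simp_all [VTerm.msub, VTerm.fv]
    | some v =>
      simp only [VTerm.msub, hx, Option.getD_some, hρ x v hx] at hy
      simp at hy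
  | lam x t ih =>
    intro ρ hρ y hy
    simp only [VTerm.msub, VTerm.fv, Finset.mem_sdiff, Finset.mem_singleton] at hy ⊢
    have := ih _ (hρ.update_none x) y hy.1
    rw [Function.update_of_ne hy.2] at this
    exact ⟨⟨this.1, hy.2⟩, this.2⟩
  | app t u iht ihu =>
    intro ρ hρ y hy
    simp only [VTerm.msub, VTerm.fv, Finset.mem_union] at hy ⊢
    rcases hy with hy | hy
    · exact ⟨.inl (iht ρ hρ y hy).1, (iht ρ hρ y hy).2⟩
    · exact ⟨.inr (ihu ρ hρ y hy).1, (ihu ρ hρ y hy).2⟩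
  | sub t x u iht ihu =>
    intro ρ hρ y hy
    simp only [VTerm.msub, VTerm.fv, Finset.mem_union, Finset.mem_sdiff,
      Finset.mem_singleton] at hy ⊢
    rcases hy with hy | hy
    · have := iht _ (hρ.update_none x) y hy.1
      rw [Function.update_of_ne hy.2] at this
      exact ⟨.inl ⟨this.1, hy.2⟩, this.2⟩
    · exact ⟨.inr (ihu ρ hρ y hy).1, (ihu ρ hρ y hy).2⟩

theorem VTerm.subst_msub (t : VTerm) (x : ℕ) (v : VTerm) :
    ∀ ρ : ℕ → Option VTerm, ClosedRange ρ → ρ x = none →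
      (t.msub ρ).subst x v = t.msub (Function.update ρ x (some v)) := by
  induction t with
  | var y =>
    intro ρ hρ hx
    by_cases hyx : y = x
    · subst hyx; simp [VTerm.msub, hx, VTerm.subst]
    · cases hy : ρ y with
      | none => simp [VTerm.msub, hy, VTerm.subst, hyx]
      | some w =>
        simp only [VTerm.msub, hy, Option.getD_some, Function.update_of_ne hyx]
        exact VTerm.subst_eq_self w x v (by simp [hρ y w hy])
  | lam y t ih =>
    intro ρ hρ hx
    by_cases hyx : y = x
    · subst hyx; simp [VTerm.msub, VTerm.subst]
    · simp only [VTerm.msub, VTerm.subst, hyx, if_false]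
      rw [ih _ (hρ.update_none y) (by rw [Function.update_of_ne (Ne.symm hyx), hx]),
        Function.update_comm (Ne.symm hyx)]
  | app t u iht ihu =>
    intro ρ hρ hx
    simp only [VTerm.msub, VTerm.subst, iht ρ hρ hx, ihu ρ hρ hx]
  | sub t y u iht ihu =>
    intro ρ hρ hx
    by_cases hyx : y = x
    · subst hyx; simp [VTerm.msub, VTerm.subst, ihu ρ hρ hx]
    · simp only [VTerm.msub, VTerm.subst, hyx, if_false]
      rw [iht _ (hρ.update_none y) (by rw [Function.update_of_ne (Ne.symm hyx), hx]),
        Function.update_comm (Ne.symm hyx), ihu ρ hρ hx]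

/-- Substituting one more closed term below a binder. -/
theorem VTerm.subst_msub_update_none (t : VTerm) (x : ℕ) (v : VTerm)
    {ρ : ℕ → Option VTerm} (hρ : ClosedRange ρ) :
    (t.msub (Function.update ρ x none)).subst x v = t.msub (Function.update ρ x (some v)) := by
  rw [VTerm.subst_msub t x v _ (hρ.update_none x) (by simp), Function.update_idem]

theorem vstep_sub_value (t : VTerm) (x : ℕ) {v : VTerm} (hv : v.isValue) :
    VStep 0 (.sub t x v) (t.subst x v) :=
  .root 0 (VRoot.subv .hole t x v hv (by simp [VLCtx.binders]))

theorem vsteps_beta_value (x : ℕ) (s : VTerm) {v : VTerm} (hv : v.isValue) :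
    ReflTransGen (VStep 0) (.app (.lam x s) v) (s.subst x v) :=
  .head (.root 0 (VRoot.beta .hole x s v (by simp [VLCtx.binders])))
    (.single (vstep_sub_value s x hv))

mutual
/-- Realizability interpretation of types as sets of closed values. -/
def VTy.interp : VTy → VTerm → Prop
  | .tvar _, v => v.ClosedValue
  | .mult M, v => v.ClosedValue ∧ VTy.interpAll M v
  | .arr M σ, v => v.ClosedValue ∧ ∀ w, w.ClosedValue → VTy.interpAll M w →
      ∃ r, VTy.interp σ r ∧ ReflTransGen (VStep 0) (.app v w) r
/-- Membership in the interpretation of every type of a list. -/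
def VTy.interpAll : List VTy → VTerm → Prop
  | [], _ => True
  | σ :: M, v => VTy.interp σ v ∧ VTy.interpAll M v
end

theorem VTy.interpAll_iff (M : List VTy) (v : VTerm) :
    VTy.interpAll M v ↔ ∀ σ ∈ M, VTy.interp σ v := by
  induction M with
  | nil => simp [VTy.interpAll]
  | cons σ M ih => simp [VTy.interpAll, ih]

theorem VTy.interp_mult_iff (M : List VTy) (v : VTerm) :
    VTy.interp (.mult M) v ↔ v.ClosedValue ∧ ∀ σ ∈ M, VTy.interp σ v := by
  rw [VTy.interp, VTy.interpAll_iff]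

theorem VTy.interp.closedValue {σ : VTy} {v : VTerm} (h : VTy.interp σ v) : v.ClosedValue := by
  cases σ with
  | tvar _ => rwa [VTy.interp] at h
  | mult _ => rw [VTy.interp] at h; exact h.1
  | arr _ _ => rw [VTy.interp] at h; exact h.1

/-- The closed value that absorbs `n` arguments before returning the identity. -/
def VTerm.absorber : ℕ → VTerm
  | 0 => .lam 0 (.var 0)
  | n + 1 => .lam 0 (VTerm.absorber n)

theorem VTerm.closedValue_absorber (n : ℕ) : (VTerm.absorber n).ClosedValue := by
  induction n with
  | zero => simp [VTerm.absorber, VTerm.ClosedValue, VTerm.isValue, VTerm.fv]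
  | succ n ih => exact ⟨trivial, by simp [VTerm.absorber, VTerm.fv, ih.2]⟩

mutual
/-- Every type is realized by all sufficiently large absorbers. -/
theorem VTy.exists_interp_absorber : ∀ σ : VTy, ∃ n, ∀ m ≥ n, VTy.interp σ (VTerm.absorber m)
  | .tvar _ => ⟨0, fun m _ => by rw [VTy.interp]; exact VTerm.closedValue_absorber m⟩
  | .mult M => by
    obtain ⟨n, hn⟩ := VTy.exists_interpAll_absorber M
    exact ⟨n, fun m hm => by
      rw [VTy.interp]; exact ⟨VTerm.closedValue_absorber m, hn m hm⟩⟩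
  | .arr M σ => by
    obtain ⟨n, hn⟩ := VTy.exists_interp_absorber σ
    refine ⟨n + 1, fun m hm => ?_⟩
    obtain ⟨k, rfl⟩ : ∃ k, m = k + 1 := ⟨m - 1, by omega⟩
    rw [VTy.interp]
    refine ⟨VTerm.closedValue_absorber _, fun w hw _ => ⟨_, hn k (by omega), ?_⟩⟩
    have := vsteps_beta_value 0 (VTerm.absorber k) hw.1
    rwa [VTerm.subst_eq_self _ _ _ (by simp [(VTerm.closedValue_absorber k).2])] at this
theorem VTy.exists_interpAll_absorber :
    ∀ M : List VTy, ∃ n, ∀ m ≥ n, VTy.interpAll M (VTerm.absorber m)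
  | [] => ⟨0, fun _ _ => by rw [VTy.interpAll]; trivial⟩
  | σ :: M => by
    obtain ⟨n, hn⟩ := VTy.exists_interp_absorber σ
    obtain ⟨k, hk⟩ := VTy.exists_interpAll_absorber M
    exact ⟨max n k, fun m hm => by
      rw [VTy.interpAll]
      exact ⟨hn m (le_trans (le_max_left _ _) hm), hk m (le_trans (le_max_right _ _) hm)⟩⟩
end

theorem VCtxSum_subset {Γs : List (ℕ → List VTy)} {Γ : ℕ → List VTy} (h : Γ ∈ Γs) (y : ℕ) :
    Γ y ⊆ VCtxSum Γs y := by
  induction Γs with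
  | nil => simp at h
  | cons Δ Γs ih =>
    simp only [VCtxSum, VCtxAdd]
    rcases List.mem_cons.1 h with rfl | h
    · exact List.subset_append_left _ _
    · exact List.Subset.trans (ih h) (List.subset_append_right _ _)

/-- `ρ` maps the variables in `s` to realizers of the types assigned by `Γ`. -/
def Realizes (ρ : ℕ → Option VTerm) (s : Finset ℕ) (Γ : ℕ → List VTy) : Prop :=
  ∀ x ∈ s, ∃ v, ρ x = some v ∧ VTy.interp (.mult (Γ x)) v

theorem Realizes.mono {ρ : ℕ → Option VTerm} {s s' : Finset ℕ} {Γ Γ' : ℕ → List VTy}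
    (h : Realizes ρ s Γ) (hs : s' ⊆ s) (hΓ : ∀ x, Γ' x ⊆ Γ x) : Realizes ρ s' Γ' := by
  intro x hx
  obtain ⟨v, hv, hi⟩ := h x (hs hx)
  rw [VTy.interp_mult_iff] at hi
  exact ⟨v, hv, (VTy.interp_mult_iff _ _).2 ⟨hi.1, fun σ hσ => hi.2 σ (hΓ x hσ)⟩⟩

theorem Realizes.update {ρ : ℕ → Option VTerm} {s : Finset ℕ} {Γ : ℕ → List VTy} {x : ℕ}
    {M : List VTy} {w : VTerm} (h : Realizes ρ (s \ {x}) Γ) (hw : VTy.interp (.mult M) w) :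
    Realizes (Function.update ρ x (some w)) s (VCtxUpd Γ x M) := by
  intro y hy
  by_cases hyx : y = x
  · subst hyx; exact ⟨w, by simp, by simpa [VCtxUpd] using hw⟩
  · rw [Function.update_of_ne hyx]
    simpa [VCtxUpd, hyx] using h y (by simp [hy, hyx])

theorem vsteps_app {t t' u u' : VTerm} (ht : ReflTransGen (VStep 0) t t')
    (hu : ReflTransGen (VStep 0) u u') :
    ReflTransGen (VStep 0) (.app t u) (.app t' u') :=
  (ht.lift (VTerm.app · u) fun _ _ h => .appL u h).trans
    (hu.lift (VTerm.app t') fun _ _ h => .appR t' h)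

/-- Adequacy: closing instances of a typed term by realizers evaluate to realizers. -/
theorem VDer.adequacy {Γ : ℕ → List VTy} {t : VTerm} {σ : VTy} (h : VDer Γ t σ) :
    ∀ ρ : ℕ → Option VTerm, ClosedRange ρ → Realizes ρ t.fv Γ →
      ∃ r, VTy.interp σ r ∧ ReflTransGen (VStep 0) (t.msub ρ) r := by
  induction h with
  | var x M =>
    intro ρ _ hΓ
    obtain ⟨v, hv, hi⟩ := hΓ x (by simp [VTerm.fv])
    exact ⟨v, by simpa [VCtxSing] using hi, by simp [VTerm.msub, hv, ReflTransGen.refl]⟩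
  | lam x t fam _ ih =>
    intro ρ hρ hΓ
    refine ⟨_, ?_, .refl⟩
    have hclosed : ((VTerm.lam x t).msub ρ).ClosedValue := by
      refine ⟨trivial, Finset.eq_empty_of_forall_notMem fun y hy => ?_⟩
      obtain ⟨hy, hn⟩ := VTerm.fv_msub _ ρ hρ y hy
      obtain ⟨v, hv, _⟩ := hΓ y hy
      simp [hn] at hv
    rw [VTy.interp_mult_iff]
    refine ⟨hclosed, fun τ hτ => ?_⟩
    obtain ⟨p, hp, rfl⟩ := List.mem_map.1 hτ
    rw [VTy.interp]
    refine ⟨hclosed, fun w hw hwM => ?_⟩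
    have hmono : Realizes ρ (t.fv \ {x}) p.1 :=
      hΓ.mono subset_rfl (VCtxSum_subset (List.mem_map_of_mem hp))
    obtain ⟨r, hr, hred⟩ := ih p hp _ (hρ.update_some x hw.2)
      (hmono.update (by rw [VTy.interp]; exact ⟨hw, hwM⟩))
    refine ⟨r, hr, (vsteps_beta_value x _ hw.1).trans ?_⟩
    rwa [VTerm.subst_msub_update_none t x w hρ]
  | @app Γ₁ Γ₂ t u M σ _ _ iht ihu =>
    intro ρ hρ hΓ
    obtain ⟨v, hv, hvred⟩ := iht ρ hρ
      (hΓ.mono Finset.subset_union_left fun _ => List.subset_append_left _ _)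
    obtain ⟨w, hw, hwred⟩ := ihu ρ hρ
      (hΓ.mono Finset.subset_union_right fun _ => List.subset_append_right _ _)
    have hv := ((VTy.interp_mult_iff _ _).1 hv).2 (.arr M σ) (List.mem_singleton_self _)
    rw [VTy.interp] at hv
    rw [VTy.interp] at hw
    obtain ⟨r, hr, hred⟩ := hv.2 w hw.1 hw.2
    exact ⟨r, hr, (vsteps_app hvred hwred).trans hred⟩
  | @es Γ₁ Γ₂ t u x M σ _ _ iht ihu =>
    intro ρ hρ hΓ
    obtain ⟨w, hw, hwred⟩ := ihu ρ hρ
      (hΓ.mono Finset.subset_union_right fun _ => List.subset_append_right _ _)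
    have hmono : Realizes ρ (t.fv \ {x}) Γ₁ :=
      hΓ.mono Finset.subset_union_left fun _ => List.subset_append_left _ _
    obtain ⟨r, hr, hred⟩ := iht _ (hρ.update_some x hw.closedValue.2) (hmono.update hw)
    refine ⟨r, hr, ?_⟩
    rw [← VTerm.subst_msub_update_none t x w hρ] at hred
    exact (hwred.lift (VTerm.sub (t.msub (Function.update ρ x none)) x)
      fun _ _ h => .subR _ x h).trans (.head (vstep_sub_value _ x hw.closedValue.1) hred)

/-- The testing context that binds each variable of a list to its image under `g`. -/
def VTCtx.closing (g : ℕ → VTerm) : List ℕ → VTCtx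
  | [] => .hole
  | x :: l => .lamApp x (VTCtx.closing g l) (g x)

theorem VTCtx.vsteps_closing {g : ℕ → VTerm} (hg : ∀ x, (g x).ClosedValue) (t : VTerm)
    (l : List ℕ) : ∀ ρ : ℕ → Option VTerm, ClosedRange ρ →
      ReflTransGen (VStep 0) (((VTCtx.closing g l).plug t).msub ρ)
        (t.msub fun y => if y ∈ l then some (g y) else ρ y) := by
  induction l with
  | nil => intro ρ _; simp [VTCtx.closing, VTCtx.plug, ReflTransGen.refl]
  | cons x l ih =>
    intro ρ hρ
    simp only [VTCtx.closing, VTCtx.plug, VTerm.msub]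
    rw [VTerm.msub_eq_self (g x) ρ (by simp [(hg x).2])]
    refine (vsteps_beta_value x _ (hg x).1).trans ?_
    rw [VTerm.subst_msub_update_none _ x _ hρ]
    convert ih _ (hρ.update_some x (hg x).2) using 3 with y
    by_cases hyx : y = x
    · subst hyx; simp
    · simp [hyx]

theorem VDer.meaningful {Γ : ℕ → List VTy} {t : VTerm} {σ : VTy} (h : VDer Γ t σ) :
    VMeaningful t := by
  choose n hn using fun x => VTy.exists_interp_absorber (.mult (Γ x))
  have hg : ∀ x, (VTerm.absorber (n x)).ClosedValue := fun x => VTerm.closedValue_absorber _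
  have hred := VTCtx.vsteps_closing hg t t.fv.toList (fun _ => none) (by intro x v hx; simp at hx)
  rw [VTerm.msub_eq_self (VTCtx.plug _ _) _ (by simp)] at hred
  obtain ⟨r, hr, hr'⟩ := h.adequacy
    (fun y => if y ∈ t.fv.toList then some (VTerm.absorber (n y)) else none)
    (by
      intro x v hx
      dsimp only at hx
      split at hx
      · cases hx; exact (hg x).2
      · simp at hx)
    (fun x hx => ⟨_, by simp [hx], hn x _ le_rfl⟩)
  exact ⟨_, r, hr.closedValue.1, hred.trans hr'⟩

/-- (λvsub Typed Genericity) If `t` is meaningless and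
`Γ ⊢ C⟨t⟩ : σ` is derivable in system 𝒱, then `Γ ⊢ C⟨u⟩ : σ` is derivable
for every term `u`. -/
theorem vsub_typed_genericity (t : VTerm) (ht : ¬ VMeaningful t)
    (C : VFCtx) (Γ : ℕ → List VTy) (σ : VTy)
    (h : VDer Γ (VFCtx.plug C t) σ) :
    ∀ u : VTerm, VDer Γ (VFCtx.plug C u) σ := by
  intro u
  induction C generalizing Γ σ with
  | hole => exact absurd h.meaningful ht
  | lam x C ih =>
    cases h with
    | lam _ _ fam hfam => exact .lam x _ fam fun p hp => ih _ _ (hfam p hp)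
  | appL C s ih =>
    cases h with
    | app M _ h₁ h₂ => exact .app M σ (ih _ _ h₁) h₂
  | appR s C ih =>
    cases h with
    | app M _ h₁ h₂ => exact .app M σ h₁ (ih _ _ h₂)
  | subL C x s ih =>
    cases h with
    | es _ M _ h₁ h₂ => exact .es x M σ (ih _ _ h₁) h₂
  | subR s x C ih =>
    cases h with
    | es _ M _ h₁ h₂ => exact .es x M σ h₁ (ih _ _ h₂)
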